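/- arXiv:2603.03923 — 3 statements merged into one kernel-verified Lean document; each statement's English description precedes it below -/
import Mathlib

section
/- Let B be a group, A an abelian normal subgroup of B containing no element of order 2 (i.e. a ∈ A and a² = 1 imply a = 1), z a central element of B with z² = 1, and j ∈ B an element with z * j² ∈ A. Assume that every 4-periodic 2-cocycle on ℤ with values in A (for conjugation by powers of j) is a coboundary, i.e.: for every function c : ℤ × ℤ → A that is 4-periodic in each argument and satisfies (j^a * c(b,d) * j^{−a}) * c(a, b+d) = c(a+b, d) * c(a,b) for all a, b, d ∈ ℤ, there exists a 4-periodic function w : ℤ → A with c(a,b) = (j^a * w(b) * j^{−a}) * w(a+b)⁻¹ * w(a) for all a, b ∈ ℤ. Then there exists u ∈ A such that (j * u⁻¹)² = z. -/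
/-- Given a group `B`, an abelian normal subgroup `A` without `2`-torsion, a
central element `z` with `z² = 1`, and `j ∈ B` with `z * j² ∈ A`, if every
`4`-periodic `2`-cocycle on `ℤ` with values in `A` (for conjugation by powers
of `j`) is a coboundary, then `j` can be corrected by an element `u` of `A`
so that `(j * u⁻¹)² = z`. -/
theorem exists_correction_sq_eq_central
    (B : Type*) [Group B] (A : Subgroup B) [A.Normal]
    (hA : ∀ a ∈ A, ∀ b ∈ A, a * b = b * a)
    (hA2 : ∀ a ∈ A, a ^ 2 = 1 → a = 1)
    (z : B) (hz : ∀ b : B, z * b = b * z) (hz2 : z ^ 2 = 1)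
    (j : B) (hj : z * j ^ 2 ∈ A)
    (hcb : ∀ c : ℤ → ℤ → B, (∀ a b : ℤ, c a b ∈ A) →
      (∀ a b : ℤ, c (a + 4) b = c a b) →
      (∀ a b : ℤ, c a (b + 4) = c a b) →
      (∀ a b d : ℤ, (j ^ a * c b d * j ^ (-a)) * c a (b + d) = c (a + b) d * c a b) →
      ∃ w : ℤ → B, (∀ a : ℤ, w a ∈ A) ∧ (∀ a : ℤ, w (a + 4) = w a) ∧
        ∀ a b : ℤ, c a b = (j ^ a * w b * j ^ (-a)) * (w (a + b))⁻¹ * w a) :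
    ∃ u ∈ A, (j * u⁻¹) ^ 2 = z := by
  have hv_sq : (z * j ^ 2) ^ 2 = j ^ 4 := by
    rw [(show Commute z (j ^ 2) from hz _).mul_pow, hz2, one_mul, ← pow_mul]
  have hj4 : j ^ (4 : ℤ) ∈ A := by
    have h := A.pow_mem hj 2
    rw [hv_sq] at h
    exact_mod_cast h
  -- The cocycle of the section `a ↦ j ^ (a % 4)`.
  obtain ⟨w, hwA, hper, hw⟩ := hcb (fun a b => j ^ (a % 4 + b % 4 - (a + b) % 4))
    (fun a b => by
      obtain ⟨k, hk⟩ : (4 : ℤ) ∣ a % 4 + b % 4 - (a + b) % 4 := by omega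
      simp only [hk, zpow_mul]
      exact A.zpow_mem hj4 k)
    (fun a b => by
      have h : (a + 4) % 4 + b % 4 - (a + 4 + b) % 4 = a % 4 + b % 4 - (a + b) % 4 := by omega
      simp only [h])
    (fun a b => by
      have h : a % 4 + (b + 4) % 4 - (a + (b + 4)) % 4 = a % 4 + b % 4 - (a + b) % 4 := by omega
      simp only [h])
    (fun a b d => by
      simp only [← zpow_add, add_assoc]
      congr 1
      ring)
  have h0 := hw 1 0
  have h1 := hw 1 1
  have h2 := hw 1 2
  have h3 := hw 1 3
  norm_num at h0 h1 h2 h3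
  have hx := hwA 1
  set x := w 1
  have hy : j * x * j⁻¹ ∈ A := ‹A.Normal›.conj_mem x hx j
  have hcomm := hA x hx _ hy
  have hj2 : ∀ a ∈ A, j ^ 2 * a = a * j ^ 2 := fun a ha => by
    have h := hA _ hj a ha
    rw [mul_assoc, ← mul_assoc a, ← hz a, mul_assoc z] at h
    exact mul_left_cancel h
  -- If `1 = p * q⁻¹ * x` in `A`, then `q = p * x`.
  have solve : ∀ p q : B, q ∈ A → 1 = p * q⁻¹ * x → q = p * x := fun p q hq h => by
    rw [mul_assoc, hA _ (A.inv_mem hq) x hx, ← mul_assoc] at h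
    exact (mul_inv_eq_one.mp h.symm).symm
  have hw2 : w 2 = j * x * j⁻¹ * x := solve _ _ (hwA 2) h1
  have hw3 : w 3 = j * w 2 * j⁻¹ * x := solve _ _ (hwA 3) h2
  have hw4 : w 4 = 1 := by
    have h := hper 0
    rw [zero_add] at h
    rw [h]
    exact conj_eq_one_iff.mp h0.symm
  have hjw3 : j * w 3 * j⁻¹ = w 2 * (j * x * j⁻¹) := by
    calc j * w 3 * j⁻¹ = j ^ 2 * w 2 * (j ^ 2)⁻¹ * (j * x * j⁻¹) := by
          rw [hw3, sq]
          group
      _ = w 2 * (j * x * j⁻¹) := by rw [hj2 _ (hwA 2), mul_inv_cancel_right]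
  have hw2_sq : w 2 ^ 2 = j ^ 4 := by
    have h : j ^ 4 = w 2 * (j * x * j⁻¹) * x := by
      rw [hw4, inv_one, mul_one, hjw3] at h3
      exact_mod_cast h3
    rw [h, mul_assoc, ← hw2, sq]
  have hv : z * j ^ 2 = w 2 := by
    refine mul_inv_eq_one.mp (hA2 _ (A.mul_mem hj (A.inv_mem (hwA 2))) ?_)
    rw [(show Commute _ _ from hA _ hj _ (A.inv_mem (hwA 2))).mul_pow, hv_sq, inv_pow, hw2_sq,
      mul_inv_cancel]
  have hjz : j ^ 2 = w 2 * z := by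
    rw [← hv, ← hz, ← mul_assoc, ← sq, hz2, one_mul]
  refine ⟨x, hx, ?_⟩
  calc (j * x⁻¹) ^ 2 = (j * x * j⁻¹)⁻¹ * (j ^ 2 * x⁻¹) := by rw [sq]; group
    _ = (j * x * j⁻¹)⁻¹ * (x⁻¹ * j ^ 2) := by rw [hj2 _ (A.inv_mem hx)]
    _ = (x * (j * x * j⁻¹))⁻¹ * j ^ 2 := by group
    _ = z := by rw [hcomm, ← hw2, hjz, inv_mul_cancel_left]
end

section
/- Let M and N be types each equipped with a multiplicative action of ℂˣ, with gluing maps ψ_M(x,u) = (u⁻¹ • x, u⁻¹) and ψ_N(y,u) = (u⁻¹ • y, u⁻¹). Let f : M → N satisfy f(λ • x) = λ̄ • f(x) for all λ ∈ ℂˣ and x ∈ M, where λ̄ denotes the complex conjugate. Define F₁, F₂ : M × ℂˣ → N × ℂˣ by F₁(x,u) = ((−ū⁻¹) • f(x), −ū⁻¹) and F₂(x,u) = ((−ū⁻¹) • ((−1) • f(x)), −ū⁻¹). Then for all x ∈ M and u ∈ ℂˣ, F₂(ψ_M(x,u)) = ψ_N(F₁(x,u)), and both sides equal (f(x), −ū).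 -/
/-- Complex conjugation on the group `ℂˣ` of nonzero complex numbers. -/
def uconj : ℂˣ →* ℂˣ := Units.map (starRingEnd ℂ).toMonoidHom

/-- The gluing map of the `ℂ*`-gluing construction on `M × ℂˣ`. -/
def glueMap (M : Type*) [MulAction ℂˣ M] : M × ℂˣ → M × ℂˣ :=
  fun p => (p.2⁻¹ • p.1, p.2⁻¹)

/-- First-chart formula for the map induced by `f` on the glued bundle:
`F₁(x,u) = ((−ū⁻¹) • f(x), −ū⁻¹)`. -/
noncomputable def antiHolLift₁ {M N : Type*} [MulAction ℂˣ M] [MulAction ℂˣ N]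
    (f : M → N) : M × ℂˣ → N × ℂˣ :=
  fun p => ((-(uconj p.2)⁻¹) • f p.1, -(uconj p.2)⁻¹)

/-- Second-chart formula for the map induced by `f` on the glued bundle:
`F₂(x,u) = ((−ū⁻¹) • ((−1) • f(x)), −ū⁻¹)`. -/
noncomputable def antiHolLift₂ {M N : Type*} [MulAction ℂˣ M] [MulAction ℂˣ N]
    (f : M → N) : M × ℂˣ → N × ℂˣ :=
  fun p => ((-(uconj p.2)⁻¹) • ((-1 : ℂˣ) • f p.1), -(uconj p.2)⁻¹)

/-- A conjugate-equivariant map `f : M → N` induces a well-defined map on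
the glued bundles: `F₂ ∘ ψ_M = ψ_N ∘ F₁`, and both sides equal `(f(x), −ū)`. -/
theorem antiHolLift_glue_compat
    (M N : Type*) [MulAction ℂˣ M] [MulAction ℂˣ N]
    (f : M → N) (hf : ∀ (lam : ℂˣ) (x : M), f (lam • x) = uconj lam • f x)
    (x : M) (u : ℂˣ) :
    antiHolLift₂ f (glueMap M (x, u)) = glueMap N (antiHolLift₁ f (x, u)) ∧
    antiHolLift₂ f (glueMap M (x, u)) = (f x, -(uconj u)) ∧
    glueMap N (antiHolLift₁ f (x, u)) = (f x, -(uconj u)) := by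
  have h₂ : antiHolLift₂ f (glueMap M (x, u)) = (f x, -(uconj u)) := by
    simp [antiHolLift₂, glueMap, hf, smul_smul]
  have h₁ : glueMap N (antiHolLift₁ f (x, u)) = (f x, -(uconj u)) := by
    simp [antiHolLift₁, glueMap, smul_smul]
  exact ⟨h₂.trans h₁.symm, h₂, h₁⟩
end

section
/- Let M be a type equipped with a multiplicative action of ℂˣ, and let f : M → M satisfy f(λ • x) = λ̄ • f(x) for all λ ∈ ℂˣ and x ∈ M, where λ̄ is the complex conjugate. Define g : M × ℂˣ → M × ℂˣ by g(x,u) = ((−ū⁻¹) • f(x), −ū⁻¹). Then g(g(x,u)) = ((−1) • f(f(x)), u) for all x ∈ M and u ∈ ℂˣ. Consequently: (1) g ∘ g = id if and only if f(f(x)) = (−1) • x for all x ∈ M (f is a quaternionic structure); and (2) g(g(x,u)) = ((−1) • x, u) for all (x,u) if and only if f ∘ f = id (f is a real structure). -/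
/-- The map induced on `M × ℂˣ` by a conjugate-equivariant map `f : M → M`:
`g(x,u) = ((−ū⁻¹) • f(x), −ū⁻¹)`. -/
noncomputable def antiHolLift {M : Type*} [MulAction ℂˣ M] (f : M → M) : M × ℂˣ → M × ℂˣ :=
  fun p => ((-(uconj p.2)⁻¹) • f p.1, -(uconj p.2)⁻¹)

@[simp]
theorem uconj_uconj (u : ℂˣ) : uconj (uconj u) = u := by
  ext
  simp [uconj]

@[simp]
theorem uconj_neg (u : ℂˣ) : uconj (-u) = -uconj u := by
  ext
  simp [uconj]

theorem antiHolLift_antiHolLift {M : Type*} [MulAction ℂˣ M] {f : M → M}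
    (hf : ∀ (lam : ℂˣ) (x : M), f (lam • x) = uconj lam • f x) (x : M) (u : ℂˣ) :
    antiHolLift f (antiHolLift f (x, u)) = ((-1 : ℂˣ) • f (f x), u) := by
  simp [antiHolLift, hf, smul_smul, inv_neg]

/-- For a conjugate-equivariant `f : M → M`, the induced map `g` on `M × ℂˣ`
satisfies `g(g(x,u)) = ((−1) • f(f(x)), u)`; hence `g` is an involution iff
`f` is a quaternionic structure, and `g` squares to the fiberwise action of
`−1` iff `f` is a real structure. -/
theorem antiHolLift_sq
    (M : Type*) [MulAction ℂˣ M]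
    (f : M → M) (hf : ∀ (lam : ℂˣ) (x : M), f (lam • x) = uconj lam • f x) :
    (∀ (x : M) (u : ℂˣ),
        antiHolLift f (antiHolLift f (x, u)) = ((-1 : ℂˣ) • f (f x), u)) ∧
    ((antiHolLift f ∘ antiHolLift f = id) ↔ ∀ x : M, f (f x) = (-1 : ℂˣ) • x) ∧
    ((∀ (x : M) (u : ℂˣ),
        antiHolLift f (antiHolLift f (x, u)) = ((-1 : ℂˣ) • x, u)) ↔ f ∘ f = id) := by
  have h := antiHolLift_antiHolLift hf
  refine ⟨h, ⟨fun hg x => ?_, fun hq => ?_⟩, ⟨fun hg => ?_, fun hr x u => ?_⟩⟩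
  · have hx : (-1 : ℂˣ) • f (f x) = x :=
      congrArg Prod.fst ((h x 1).symm.trans (congrFun hg (x, 1)))
    rw [← inv_smul_eq_iff, inv_neg, inv_one, hx]
  · funext ⟨x, u⟩
    simp [h, hq, smul_smul]
  · funext x
    exact smul_left_cancel (-1 : ℂˣ) (congrArg Prod.fst ((h x 1).symm.trans (hg x 1)))
  · rw [h, show f (f x) = x from congrFun hr x]
end
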